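/- arXiv:2504.21750 — 6 statements merged into one kernel-verified Lean document; each statement's English description precedes it below -/
import Mathlib

section
/- Let 0 < δ ≤ (3−√5)/4 and set x = (2−2δ)/(3−2δ). Then for all reals s ≥ 0 and x_l with x_l ≥ 1 − x − 2δ, one has (x_l + x + s)/(x_l + (1−x) + s) ≤ 1/x. -/
/-- Final estimate of the removability analysis: for `0 < δ ≤ (3−√5)/4`
and `x = (2−2δ)/(3−2δ)`, for all `s ≥ 0` and `x_l ≥ 1 − x − 2δ` one has
`(x_l + x + s)/(x_l + (1−x) + s) ≤ 1/x`. -/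
theorem stmt_13 (δ : ℝ) (hδ0 : 0 < δ) (hδ1 : δ ≤ (3 - Real.sqrt 5)/4)
    (x : ℝ) (hx : x = (2-2*δ)/(3-2*δ)) :
    ∀ s xl : ℝ, 0 ≤ s → 1 - x - 2*δ ≤ xl →
      (xl + x + s)/(xl + (1-x) + s) ≤ 1/x := by
  intro s xl hs hxl
  have h_sqrt : (2 : ℝ) < Real.sqrt 5 := Real.lt_sqrt_of_sq_lt (by norm_num)
  have hδ : δ < 1 / 2 := by linarith
  have h_den : 0 < 3 - 2 * δ := by linarith
  have hx_mul : x * (3 - 2 * δ) = 2 - 2 * δ := by rw [hx, div_mul_cancel₀ _ h_den.ne']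
  have hx_pos : 0 < x := by rw [hx]; exact div_pos (by linarith) h_den
  have hx_lt : x < 1 := by rw [hx, div_lt_one h_den]; linarith
  have h_pos : 0 < 1 - x - δ := by
    have h_eq : (1 - x - δ) * (3 - 2 * δ) = (1 - δ) * (1 - 2 * δ) := by linear_combination -hx_mul
    refine pos_of_mul_pos_left ?_ h_den.le
    rw [h_eq]
    exact mul_pos (by linarith) (by linarith)
  rw [div_le_div_iff₀ (by linarith) hx_pos]
  have h_mul : 0 ≤ (1 - x) * (xl + s - (1 - x - 2 * δ)) :=
    mul_nonneg (by linarith) (by linarith)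
  linarith
end

section
/- For every real δ ≥ 1/2, every deterministic online algorithm A for the online simple knapsack with item size estimates, and every real c, A is not c-competitive for accuracy δ: there exist a prediction list P and an instance x consistent with (P, δ) such that OPT(x) > c · gain_A(δ, P, x). (The prediction P = (1/2, 1/2) suffices.) -/
/-- A deterministic online algorithm: given the accuracy `δ`, the prediction
list `P`, and the actual sizes revealed so far, decide to pack (`true`)
or reject (`false`) the current item. -/
def OnlineAlg : Type := ℝ → List ℝ → List ℝ → Bool

/-- Total size packed by `A` after processing the first `i` items of `x`. -/
noncomputable def loadAux (A : OnlineAlg) (δ : ℝ) (P x : List ℝ) : ℕ → ℝ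
  | 0 => 0
  | i + 1 =>
      let m := loadAux A δ P x i
      if A δ P (x.take (i+1)) = true ∧ x.getD i 0 + m ≤ 1 then
        m + x.getD i 0
      else m

/-- The gain of algorithm `A` on instance `x` with prediction `P`. -/
noncomputable def gain (A : OnlineAlg) (δ : ℝ) (P x : List ℝ) : ℝ :=
  loadAux A δ P x x.length

/-- The optimal (offline) knapsack value of instance `x`. -/
noncomputable def OPT (x : List ℝ) : ℝ :=
  (((Finset.range x.length).powerset).filter
      (fun S => ∑ i ∈ S, x.getD i 0 ≤ 1)).sup'
    ⟨∅, by simp⟩ (fun S => ∑ i ∈ S, x.getD i 0)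

/-- The instance `x` is consistent with the prediction `P` and accuracy `δ`. -/
def Consistent (δ : ℝ) (P x : List ℝ) : Prop :=
  x.length = P.length ∧
  ∀ i < x.length,
    0 ≤ x.getD i 0 ∧ x.getD i 0 ≤ 1 ∧
    P.getD i 0 - δ ≤ x.getD i 0 ∧ x.getD i 0 ≤ P.getD i 0 + δ

/-- `A` is `c`-competitive for accuracy `δ`. -/
def Competitive (A : OnlineAlg) (δ c : ℝ) : Prop :=
  ∀ P x : List ℝ, Consistent δ P x → OPT x ≤ c * gain A δ P x

theorem getD_le_OPT {x : List ℝ} {i : ℕ} (hi : i < x.length) (h : x.getD i 0 ≤ 1) :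
    x.getD i 0 ≤ OPT x := by
  have hmem : ({i} : Finset ℕ) ∈ ((Finset.range x.length).powerset).filter
      (fun S => ∑ j ∈ S, x.getD j 0 ≤ 1) := by
    rw [Finset.mem_filter, Finset.mem_powerset, Finset.singleton_subset_iff, Finset.mem_range,
      Finset.sum_singleton]
    exact ⟨hi, h⟩
  have hle := Finset.le_sup' (fun S => ∑ j ∈ S, x.getD j 0) hmem
  rwa [Finset.sum_singleton] at hle

theorem consistent_half_pair {δ a b : ℝ} (hδ : 1 / 2 ≤ δ) (ha : 0 ≤ a) (ha' : a ≤ 1)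
    (hb : 0 ≤ b) (hb' : b ≤ 1) : Consistent δ [1 / 2, 1 / 2] [a, b] := by
  refine ⟨rfl, fun i hi => ?_⟩
  have hi' : i < 2 := hi
  interval_cases i <;> simp only [List.getD_cons_zero, List.getD_cons_succ] <;>
    refine ⟨?_, ?_, ?_, ?_⟩ <;> linarith

/-- For every `δ ≥ 1/2`, no deterministic online algorithm is `c`-competitive
for any constant `c`. -/
theorem stmt_15 (δ : ℝ) (hδ : 1/2 ≤ δ) (A : OnlineAlg) (c : ℝ) :
    ∃ P x : List ℝ, Consistent δ P x ∧ c * gain A δ P x < OPT x := by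
  obtain ⟨ε, hε, hε1, hcε⟩ : ∃ ε : ℝ, 0 < ε ∧ ε ≤ 1 ∧ c * ε < 1 := by
    have hc : 0 < |c| + 1 := by positivity
    refine ⟨1 / (|c| + 1), by positivity, ?_, ?_⟩
    · rw [div_le_one hc]
      linarith [abs_nonneg c]
    · rw [mul_one_div, div_lt_one hc]
      linarith [le_abs_self c]
  by_cases hA : A δ [1 / 2, 1 / 2] [ε] = true
  · refine ⟨[1 / 2, 1 / 2], [ε, 1],
      consistent_half_pair hδ hε.le hε1 zero_le_one le_rfl, ?_⟩
    have hgain : gain A δ [1 / 2, 1 / 2] [ε, 1] = ε := by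
      have hfull : ¬ (1 + ε ≤ 1) := by linarith
      simp only [gain, loadAux, List.length_cons, List.length_nil, List.take_succ_cons,
        List.take_zero, List.getD_cons_zero, List.getD_cons_succ, hA, add_zero, zero_add, hε1,
        hfull, and_self, and_false, if_true, if_false]
    rw [hgain]
    exact hcε.trans_le (getD_le_OPT (x := [ε, 1]) (i := 1) (by simp) (by simp))
  · refine ⟨[1 / 2, 1 / 2], [ε, 0],
      consistent_half_pair hδ hε.le hε1 le_rfl zero_le_one, ?_⟩
    have hgain : gain A δ [1 / 2, 1 / 2] [ε, 0] = 0 := by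
      simp only [gain, loadAux, List.length_cons, List.length_nil, List.take_succ_cons,
        List.take_zero, List.getD_cons_zero, List.getD_cons_succ, hA,
        Bool.false_eq_true, false_and, if_false, add_zero, ite_self]
    rw [hgain, mul_zero]
    exact hε.trans_le (getD_le_OPT (x := [ε, 0]) (i := 0) (by simp) (by simpa using hε1))
end

section
/- For every real δ with 0 < δ < 1/2, there exists a deterministic online algorithm A for the online simple knapsack with item size estimates that is 2/(1−2δ)-competitive for accuracy δ: for every prediction list P and every instance x consistent with (P, δ), OPT(x) ≤ (2/(1−2δ)) · gain_A(δ, P, x). -/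
/-- Packs only one item announced with size at least `1/2` if there is one, and otherwise packs
greedily. -/
noncomputable def singleLargeOrGreedy : OnlineAlg := fun _ P h =>
  open Classical in
  if hP : ∃ i < P.length, 1 / 2 ≤ P.getD i 0 then decide (h.length = hP.choose + 1) else true

lemma loadAux_mono (A : OnlineAlg) (δ : ℝ) (P x : List ℝ) (hx : ∀ i, 0 ≤ x.getD i 0) :
    Monotone (loadAux A δ P x) := by
  refine monotone_nat_of_le_succ fun i => ?_
  simp only [loadAux]
  split_ifs
  · linarith [hx i]
  · exact le_rfl

lemma OPT_le_one (x : List ℝ) : OPT x ≤ 1 :=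
  Finset.sup'_le _ _ fun _ hS => (Finset.mem_filter.1 hS).2

lemma OPT_le_sum (x : List ℝ) (hx : ∀ i, 0 ≤ x.getD i 0) :
    OPT x ≤ ∑ i ∈ Finset.range x.length, x.getD i 0 :=
  Finset.sup'_le _ _ fun _ hS => Finset.sum_le_sum_of_subset_of_nonneg
    (Finset.mem_powerset.1 (Finset.mem_filter.1 hS).1) fun i _ _ => hx i

/-- If `A` selects exactly the item `j`, then its gain is at least the size of that item. -/
lemma getD_le_gain_of_unique {A : OnlineAlg} {δ : ℝ} {P x : List ℝ} {j : ℕ}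
    (hx : ∀ i, 0 ≤ x.getD i 0) (hj : j < x.length) (hj1 : x.getD j 0 ≤ 1)
    (hA : ∀ i < x.length, A δ P (x.take (i + 1)) = true ↔ i = j) :
    x.getD j 0 ≤ gain A δ P x := by
  have hzero : ∀ i ≤ j, loadAux A δ P x i = 0 := by
    intro i
    induction i with
    | zero => intro _; rfl
    | succ i ih =>
      intro hi
      have hne : ¬ A δ P (x.take (i + 1)) = true := by
        rw [hA i (by omega)]; omega
      simp only [loadAux, hne]
      exact ih (by omega)
  have hload : loadAux A δ P x (j + 1) = x.getD j 0 := by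
    simp only [loadAux, hzero j le_rfl, (hA j hj).2 rfl, add_zero, zero_add, true_and, if_pos hj1]
  exact hload ▸ loadAux_mono A δ P x hx hj

/-- If `A` selects every item and all items have size at most `b`, then it packs everything or its
gain exceeds `1 - b`. -/
lemma gain_eq_sum_or_lt_gain {A : OnlineAlg} {δ b : ℝ} {P x : List ℝ}
    (hx : ∀ i, 0 ≤ x.getD i 0) (hb : ∀ i < x.length, x.getD i 0 ≤ b)
    (hA : ∀ i < x.length, A δ P (x.take (i + 1)) = true) :
    gain A δ P x = ∑ i ∈ Finset.range x.length, x.getD i 0 ∨ 1 - b < gain A δ P x := by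
  by_cases h : ∀ i < x.length, x.getD i 0 + loadAux A δ P x i ≤ 1
  · left
    have hsum : ∀ n ≤ x.length,
        loadAux A δ P x n = ∑ i ∈ Finset.range n, x.getD i 0 := by
      intro n
      induction n with
      | zero => intro _; simp [loadAux]
      | succ n ih =>
        intro hn
        rw [Finset.sum_range_succ, ← ih (by omega)]
        simp only [loadAux]
        exact if_pos ⟨hA n hn, h n hn⟩
    exact hsum _ le_rfl
  · right
    push Not at h
    obtain ⟨i, hi, hlt⟩ := h
    have hle : loadAux A δ P x i ≤ gain A δ P x := loadAux_mono A δ P x hx hi.le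
    linarith [hb i hi]

/-- For every `0 < δ < 1/2` there is a `2/(1−2δ)`-competitive deterministic
online algorithm. -/
theorem stmt_16 (δ : ℝ) (hδ0 : 0 < δ) (hδ1 : δ < 1/2) :
    ∃ A : OnlineAlg, Competitive A δ (2/(1-2*δ)) := by
  refine ⟨singleLargeOrGreedy, fun P x ⟨hlen, hcons⟩ => ?_⟩
  have hx : ∀ i, 0 ≤ x.getD i 0 := fun i => by
    rcases lt_or_ge i x.length with hi | hi
    · exact (hcons i hi).1
    · rw [List.getD_eq_default _ _ hi]
  have hpos : 0 < 1 - 2 * δ := by linarith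
  rw [div_mul_eq_mul_div, le_div_iff₀ hpos]
  have hOPT := OPT_le_one x
  have large : 1 / 2 - δ ≤ gain singleLargeOrGreedy δ P x →
      OPT x * (1 - 2 * δ) ≤ 2 * gain singleLargeOrGreedy δ P x := fun h => by
    nlinarith
  by_cases hP : ∃ i < P.length, 1 / 2 ≤ P.getD i 0
  · obtain ⟨hj, hhalf⟩ := hP.choose_spec
    replace hj := hj.trans_eq hlen.symm
    obtain ⟨-, h1, hlow, -⟩ := hcons _ hj
    refine large (le_trans (by linarith) (getD_le_gain_of_unique hx hj h1 fun i hi => ?_))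
    rw [singleLargeOrGreedy, dif_pos hP, decide_eq_true_iff, List.length_take,
      min_eq_left (Nat.succ_le_of_lt hi), Nat.succ_inj]
  · have hb : ∀ i < x.length, x.getD i 0 ≤ 1 / 2 + δ := fun i hi => by
      have hsmall : P.getD i 0 < 1 / 2 := not_le.1 fun h => hP ⟨i, hlen ▸ hi, h⟩
      linarith [(hcons i hi).2.2.2]
    have hA : ∀ i < x.length, singleLargeOrGreedy δ P (x.take (i + 1)) = true :=
      fun i _ => by rw [singleLargeOrGreedy, dif_neg hP]
    rcases gain_eq_sum_or_lt_gain hx hb hA with h | h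
    · have hle := OPT_le_sum x hx
      have hnonneg := Finset.sum_nonneg fun i (_ : i ∈ Finset.range x.length) => hx i
      rw [← h] at hle hnonneg
      nlinarith
    · exact large (by linarith)
end

section
/- Let 0 < δ < 1/2, let k₁ = ⌊2/(1−2δ)⌋, and let p = −1/(2k₁) + √(1/(4k₁²) + (1−2δ)/k₁). Then for every deterministic online algorithm A for the online simple knapsack with item size estimates and every real c with c < 1/p, A is not c-competitive for accuracy δ: there exist a prediction list P and an instance x consistent with (P, δ) such that OPT(x) > c · gain_A(δ, P, x). -/
section Gain

variable {A : OnlineAlg} {δ : ℝ} {P : List ℝ}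

theorem loadAux_append (x y : List ℝ) {i : ℕ} (hi : i ≤ x.length) :
    loadAux A δ P (x ++ y) i = loadAux A δ P x i := by
  induction i with
  | zero => rfl
  | succ i ih =>
    have hget : (x ++ y).getD i 0 = x.getD i 0 := List.getD_append _ _ _ _ hi
    simp only [loadAux, ih (Nat.le_of_succ_le hi), hget, List.take_append_of_le_length hi]

@[simp] theorem gain_nil : gain A δ P [] = 0 := rfl

theorem gain_concat (x : List ℝ) (a : ℝ) :
    gain A δ P (x ++ [a]) =
      if A δ P (x ++ [a]) = true ∧ a + gain A δ P x ≤ 1 then gain A δ P x + a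
      else gain A δ P x := by
  have hlen : (x ++ [a]).length = x.length + 1 := by simp
  have hget : (x ++ [a]).getD x.length 0 = a := by simp
  have htake : (x ++ [a]).take (x.length + 1) = x ++ [a] :=
    List.take_of_length_le hlen.le
  rw [gain, hlen]
  simp only [loadAux, loadAux_append x [a] le_rfl, hget, htake, gain]
  congr

theorem gain_append_of_zero_or_too_large (x : List ℝ) {y : List ℝ}
    (hy : ∀ a ∈ y, a = 0 ∨ 1 < a + gain A δ P x) :
    gain A δ P (x ++ y) = gain A δ P x := by
  induction y using List.reverseRecOn with
  | nil => simp
  | append_singleton y a ih =>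
    have ih := ih fun b hb => hy b (by simp [hb])
    rw [← List.append_assoc, gain_concat, ih]
    rcases hy a (by simp) with rfl | ha
    · simp
    · rw [if_neg fun h => absurd h.2 ha.not_ge]

/-- When copies of `s` are offered, either all are rejected or there is a first packed one. -/
theorem gain_append_replicate (x : List ℝ) (s : ℝ) (n : ℕ) :
    gain A δ P (x ++ List.replicate n s) = gain A δ P x ∨
      ∃ j < n, gain A δ P (x ++ List.replicate (j + 1) s) = gain A δ P x + s := by
  induction n with
  | zero => simp
  | succ n ih =>
    rcases ih with ih | ⟨j, hj, h⟩
    · have h := gain_concat (A := A) (δ := δ) (P := P) (x ++ List.replicate n s) s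
      rw [List.append_assoc, ← List.replicate_succ', ih] at h
      split_ifs at h
      · exact Or.inr ⟨n, n.lt_succ_self, h⟩
      · exact Or.inl h
    · exact Or.inr ⟨j, hj.trans n.lt_succ_self, h⟩

/-- The adversary's opening: tiny items of size `ε` until the first one is packed, then zeros. -/
theorem exists_tiny_items {ε : ℝ} (hε : 0 ≤ ε) (N : ℕ) :
    ∃ t : List ℝ, t.length = N ∧ (∀ y ∈ t, 0 ≤ y ∧ y ≤ ε) ∧
      (gain A δ P t = ε ∨ gain A δ P t = 0 ∧ t = List.replicate N ε) := by
  rcases gain_append_replicate (A := A) (δ := δ) (P := P) [] ε N with h | ⟨j, hj, h⟩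
  · refine ⟨List.replicate N ε, by simp, ?_, Or.inr ⟨by simpa using h, rfl⟩⟩
    intro y hy
    rw [List.eq_of_mem_replicate hy]
    exact ⟨hε, le_rfl⟩
  · refine ⟨List.replicate (j + 1) ε ++ List.replicate (N - (j + 1)) 0, ?_, ?_, Or.inl ?_⟩
    · simp; omega
    · intro y hy
      rcases List.mem_append.1 hy with hy | hy <;> rw [List.eq_of_mem_replicate hy]
      · exact ⟨hε, le_rfl⟩
      · exact ⟨le_rfl, hε⟩
    · rw [gain_append_of_zero_or_too_large _ fun a ha => Or.inl (List.eq_of_mem_replicate ha)]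
      simpa using h

end Gain

theorem List.Sublist.exists_finset_sum_getD {l x : List ℝ} (h : l.Sublist x) :
    ∃ S ⊆ Finset.range x.length, ∑ i ∈ S, x.getD i 0 = l.sum := by
  induction h with
  | slnil => exact ⟨∅, by simp⟩
  | @cons l x a _ ih =>
    obtain ⟨S, hS, hsum⟩ := ih
    refine ⟨S.map (addRightEmbedding 1), ?_, by simpa using hsum⟩
    intro i hi
    obtain ⟨j, hj, rfl⟩ := Finset.mem_map.1 hi
    have := Finset.mem_range.1 (hS hj)
    simpa using this
  | @cons_cons l x a _ ih =>
    obtain ⟨S, hS, hsum⟩ := ih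
    refine ⟨insert 0 (S.map (addRightEmbedding 1)), ?_, ?_⟩
    · intro i hi
      rcases Finset.mem_insert.1 hi with rfl | hi
      · simp
      · obtain ⟨j, hj, rfl⟩ := Finset.mem_map.1 hi
        have := Finset.mem_range.1 (hS hj)
        simpa using this
    · rw [Finset.sum_insert (by simp)]
      simpa using hsum

theorem List.Sublist.sum_le_OPT {l x : List ℝ} (h : l.Sublist x) (hl : l.sum ≤ 1) :
    l.sum ≤ OPT x := by
  obtain ⟨S, hS, hsum⟩ := h.exists_finset_sum_getD
  rw [← hsum]
  exact Finset.le_sup' (fun S => ∑ i ∈ S, x.getD i 0)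
    (Finset.mem_filter.2 ⟨Finset.mem_powerset.2 hS, hsum.trans_le hl⟩)

theorem Consistent.append {δ : ℝ} {P Q x y : List ℝ} (hx : Consistent δ P x)
    (hy : Consistent δ Q y) : Consistent δ (P ++ Q) (x ++ y) := by
  refine ⟨by simp [hx.1, hy.1], fun i hi => ?_⟩
  rcases lt_or_ge i x.length with h | h
  · rw [List.getD_append _ _ _ _ h, List.getD_append _ _ _ _ (hx.1 ▸ h)]
    exact hx.2 i h
  · rw [List.getD_append_right _ _ _ _ h, List.getD_append_right _ _ _ _ (hx.1 ▸ h), ← hx.1]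
    exact hy.2 _ (by rw [List.length_append] at hi; omega)

theorem consistent_replicate {δ a : ℝ} {n : ℕ} {x : List ℝ} (hn : x.length = n)
    (hx : ∀ y ∈ x, 0 ≤ y ∧ y ≤ 1 ∧ a - δ ≤ y ∧ y ≤ a + δ) :
    Consistent δ (List.replicate n a) x := by
  subst hn
  refine ⟨by simp, fun i hi => ?_⟩
  rw [List.getD_replicate _ hi, List.getD_eq_getElem _ _ hi]
  exact hx _ (List.getElem_mem hi)

/-- The adversary's strategy. If no medium item is packed, the last item has its least possible
size; otherwise the last item complements the medium items or the tiny ones to a full knapsack. -/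
theorem exists_adversarial_instance {A : OnlineAlg} {δ p ε : ℝ} {k N : ℕ} (hδ : 0 < δ)
    (hp : 0 < p) (hε : 0 < ε) (hεδ : ε ≤ δ) (hk : 1 ≤ k) (hkN : k ≤ N) (hkp : k * p ≤ 1)
    (hquad : k * p ^ 2 + p = 1 - 2 * δ) (hN : N * ε = p) :
    ∃ P x : List ℝ, Consistent δ P x ∧ 0 ≤ gain A δ P x ∧
      (1 ≤ OPT x ∧ gain A δ P x ≤ p + ε ∨
        k * p ≤ OPT x ∧ gain A δ P x ≤ k * p ^ 2 + ε) := by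
  have hkp2 : k * p ^ 2 ≤ p := by nlinarith
  have hkp0 : 0 ≤ k * p ^ 2 := by positivity
  set P := List.replicate N 0 ++ List.replicate k (p + δ) ++ List.replicate 1 (1 - p - δ) with hP
  obtain ⟨t, htN, ht, htgain⟩ := exists_tiny_items (A := A) (δ := δ) (P := P) hε.le N
  have hcons : ∀ (u : List ℝ) (f : ℝ), u.length = k → (∀ y ∈ u, p ≤ y ∧ y ≤ p + 2 * δ) →
      k * p ^ 2 ≤ f → f ≤ 1 - p → Consistent δ P (t ++ u ++ [f]) := by
    intro u f hu hu' hf hf'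
    refine ((consistent_replicate htN ?_).append (consistent_replicate hu ?_)).append
      (consistent_replicate rfl ?_)
    · intro y hy
      have := ht y hy
      refine ⟨?_, ?_, ?_, ?_⟩ <;> linarith
    · intro y hy
      have := hu' y hy
      refine ⟨?_, ?_, ?_, ?_⟩ <;> linarith
    · intro y hy
      rw [List.mem_singleton.1 hy]
      refine ⟨?_, ?_, ?_, ?_⟩ <;> linarith
  obtain ⟨r, hr⟩ : ∃ r, r = p + ε - gain A δ P t := ⟨_, rfl⟩
  have hgt : 0 ≤ gain A δ P t ∧ gain A δ P t ≤ ε := by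
    rcases htgain with h | ⟨h, -⟩ <;> rw [h] <;> constructor <;> linarith
  have hr1 : p ≤ r := by linarith
  have hr2 : r ≤ p + 2 * δ := by linarith
  rcases gain_append_replicate (A := A) (δ := δ) (P := P) t r k with h | ⟨j, hj, h⟩
  · refine ⟨P, t ++ List.replicate k r ++ [k * p ^ 2],
      hcons _ _ (by simp) ?_ le_rfl (by linarith), ?_⟩
    · intro y hy
      rw [List.eq_of_mem_replicate hy]
      exact ⟨hr1, hr2⟩
    have hg : 0 ≤ gain A δ P (t ++ List.replicate k r ++ [k * p ^ 2]) ∧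
        gain A δ P (t ++ List.replicate k r ++ [k * p ^ 2]) ≤ k * p ^ 2 + ε := by
      rw [gain_concat, h]
      split_ifs <;> constructor <;> linarith
    refine ⟨hg.1, Or.inr ⟨?_, hg.2⟩⟩
    rcases htgain with h0 | ⟨h0, h1⟩
    · have hrp : r = p := by linarith
      have hsum : (List.replicate k r).sum = k * p := by simp [hrp]
      rw [← hsum]
      refine List.Sublist.sum_le_OPT ?_ (hsum.trans_le hkp)
      rw [List.append_assoc]
      exact (List.sublist_append_left _ _).trans (List.sublist_append_right _ _)
    · have hrp : r = p + ε := by linarith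
      have hsum : (List.replicate (N - (k - 1)) ε ++ List.replicate (k - 1) r).sum = k * p := by
        have : k - 1 ≤ N := by omega
        simp only [List.sum_append, List.sum_replicate, nsmul_eq_mul, hrp]
        push_cast [this, hk]
        linear_combination hN
      rw [← hsum]
      refine List.Sublist.sum_le_OPT ?_ (hsum.trans_le hkp)
      rw [h1]
      refine List.Sublist.trans ?_ (List.sublist_append_left _ _)
      exact (List.replicate_sublist_replicate _ |>.2 (by omega)).append
        (List.replicate_sublist_replicate _ |>.2 (by omega))
  · set u := List.replicate (j + 1) r ++ List.replicate (k - (j + 1)) (p + 2 * δ) with hu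
    have hg : gain A δ P (t ++ u ++ [1 - p]) = p + ε := by
      rw [hu, ← List.append_assoc, List.append_assoc,
        gain_append_of_zero_or_too_large _ fun a ha => Or.inr ?_, h, hr]
      · ring
      rw [h, hr]
      rcases List.mem_append.1 ha with ha | ha
      · rw [List.eq_of_mem_replicate ha]
        linarith
      · rw [List.mem_singleton.1 ha]
        linarith
    refine ⟨P, t ++ u ++ [1 - p], hcons _ _ (by simp [hu]; omega) ?_ (by linarith) le_rfl,
      by rw [hg]; linarith, Or.inl ⟨?_, hg.le⟩⟩
    · intro y hy
      rcases List.mem_append.1 hy with hy | hy <;> rw [List.eq_of_mem_replicate hy]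
      · exact ⟨hr1, hr2⟩
      · exact ⟨by linarith, le_rfl⟩
    rcases htgain with h0 | ⟨h0, h1⟩
    · have hrp : r = p := by linarith
      have hsum : ([r] ++ [1 - p]).sum = 1 := by simp [hrp]
      have hmem : r ∈ t ++ u := by simp [hu]
      exact hsum.ge.trans
        (((List.singleton_sublist.2 hmem).append (List.Sublist.refl _)).sum_le_OPT hsum.le)
    · have hsum : (t ++ [1 - p]).sum = 1 := by simp [h1, hN]
      exact hsum.ge.trans
        (((List.sublist_append_left t u).append (List.Sublist.refl _)).sum_le_OPT hsum.le)

/-- Lower bound `1/p`: for `0 < δ < 1/2`, no deterministic online algorithm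
achieves a competitive ratio better than `1/p`. -/
theorem stmt_17 (δ : ℝ) (hδ0 : 0 < δ) (hδ1 : δ < 1/2)
    (k₁ : ℤ) (hk : k₁ = ⌊2/(1-2*δ)⌋)
    (p : ℝ)
    (hp : p = -1/(2*(k₁:ℝ)) + Real.sqrt (1/(4*(k₁:ℝ)^2) + (1-2*δ)/(k₁:ℝ)))
    (A : OnlineAlg) (c : ℝ) (hc : c < 1/p) :
    ∃ P x : List ℝ, Consistent δ P x ∧ c * gain A δ P x < OPT x := by
  have ha : 0 < 1 - 2 * δ := by linarith
  have hfloor : (k₁ : ℝ) * (1 - 2 * δ) ≤ 2 := by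
    rw [← le_div_iff₀ ha, hk]
    exact Int.floor_le _
  have hk1 : 1 ≤ k₁ := by
    rw [hk, Int.le_floor, le_div_iff₀ ha]
    push_cast
    linarith
  obtain ⟨k, rfl⟩ := Int.eq_ofNat_of_zero_le (by omega : 0 ≤ k₁)
  have hkn : 1 ≤ k := by exact_mod_cast hk1
  simp only [Int.cast_natCast] at hp hfloor
  have hk0 : (1 : ℝ) ≤ k := by exact_mod_cast hkn
  obtain ⟨s, hs⟩ : ∃ s, s = Real.sqrt (1 / (4 * (k : ℝ) ^ 2) + (1 - 2 * δ) / k) := ⟨_, rfl⟩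
  have hs0 : 0 ≤ s := hs ▸ Real.sqrt_nonneg _
  have hs2 : s ^ 2 = 1 / (4 * (k : ℝ) ^ 2) + (1 - 2 * δ) / k := by
    rw [hs, Real.sq_sqrt (by positivity)]
  have hps : s = p + 1 / (2 * k) := by rw [hp, ← hs]; ring
  have hquad : k * p ^ 2 + p = 1 - 2 * δ := by
    rw [hps] at hs2
    field_simp at hs2
    have : (k : ℝ) ≠ 0 := by positivity
    refine mul_left_cancel₀ this ?_
    linear_combination hs2 / 16
  have hp0 : 0 < p := by
    have hlt : 1 / (2 * (k : ℝ)) < s := by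
      refine lt_of_pow_lt_pow_left₀ 2 hs0 ?_
      have : 0 < (1 - 2 * δ) / k := by positivity
      rw [hs2, div_pow, mul_pow]
      norm_num
      linarith
    linarith
  have hkp : k * p ≤ 1 := by nlinarith
  obtain ⟨d, hd⟩ : ∃ d, d = max c 0 := ⟨_, rfl⟩
  have hd0 : 0 ≤ d := hd ▸ le_max_right _ _
  have hcd : c ≤ d := hd ▸ le_max_left _ _
  have hdp : d * p < 1 := by
    rw [← lt_div_iff₀ hp0, hd]
    exact max_lt hc (by positivity)
  obtain ⟨η, hη, hηδ, hηd⟩ : ∃ η > 0, η ≤ δ ∧ d * η < (1 - d * p) * p := by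
    have hpos : 0 < (1 - d * p) * p / (d + 1) := by
      have : 0 < 1 - d * p := by linarith
      positivity
    refine ⟨min δ ((1 - d * p) * p / (d + 1)), lt_min hδ0 hpos, min_le_left _ _, ?_⟩
    calc d * min δ ((1 - d * p) * p / (d + 1)) ≤ d * ((1 - d * p) * p / (d + 1)) := by
          gcongr
          exact min_le_right _ _
      _ < (d + 1) * ((1 - d * p) * p / (d + 1)) := by gcongr; linarith
      _ = (1 - d * p) * p := by field_simp
  obtain ⟨M, hM⟩ := exists_nat_gt (p / η)
  have hN0 : (0 : ℝ) < ((M + k : ℕ) : ℝ) := by positivity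
  have hεη : p / ((M + k : ℕ) : ℝ) ≤ η := by
    rw [div_lt_iff₀ hη] at hM
    rw [div_le_iff₀ hN0]
    push_cast
    nlinarith
  obtain ⟨P, x, hcons, hg0, hx⟩ := exists_adversarial_instance (A := A) (N := M + k) hδ0 hp0
    (div_pos hp0 hN0) (hεη.trans hηδ) hkn (Nat.le_add_left _ _) hkp hquad (mul_div_cancel₀ _ hN0.ne')
  refine ⟨P, x, hcons, (mul_le_mul_of_nonneg_right hcd hg0).trans_lt ?_⟩
  rcases hx with ⟨hopt, hg⟩ | ⟨hopt, hg⟩ <;> refine lt_of_lt_of_le ?_ hopt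
  · have : d * gain A δ P x ≤ d * (p + η) := by gcongr; linarith
    nlinarith
  · have : d * gain A δ P x ≤ d * (k * p ^ 2 + η) := by gcongr; linarith
    have : (1 - d * p) * p * 1 ≤ (1 - d * p) * p * k := by
      have : 0 ≤ (1 - d * p) * p := mul_nonneg (by linarith) hp0.le
      gcongr
    nlinarith
end

section
/- Let 3/16 < δ < 1/2, let k₂ = ⌈2/(1−2δ)⌉, and let q = 1 − 2δ − 1/k₂. Then for every deterministic online algorithm A for the online simple knapsack with item size estimates and every real c with c < 1/q, A is not c-competitive for accuracy δ: there exist a prediction list P and an instance x consistent with (P, δ) such that OPT(x) > c · gain_A(δ, P, x). -/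
theorem forall_lt_not_or_exists_first (p : ℕ → Prop) (n : ℕ) :
    (∀ j < n, ¬ p j) ∨ ∃ m < n, p m ∧ ∀ j < m, ¬ p j := by
  classical
  by_cases h : ∃ m, m < n ∧ p m
  · right
    obtain ⟨h₁, h₂⟩ := Nat.find_spec h
    exact ⟨Nat.find h, h₁, h₂, fun j hj hp => Nat.find_min h hj ⟨hj.trans h₁, hp⟩⟩
  · left
    exact fun j hj hp => h ⟨j, hj, hp⟩

theorem getD_map_range (f : ℕ → ℝ) {L i : ℕ} (h : i < L) :
    ((List.range L).map f).getD i 0 = f i := by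
  simp [List.getD, h]

theorem map_range_congr {f g : ℕ → ℝ} {n : ℕ} (h : ∀ i < n, f i = g i) :
    (List.range n).map f = (List.range n).map g :=
  List.map_congr_left fun i hi => h i (List.mem_range.1 hi)

theorem loadAux_succ_map_range (A : OnlineAlg) (δ : ℝ) (P : List ℝ) (f : ℕ → ℝ) {L i : ℕ}
    (h : i < L) :
    loadAux A δ P ((List.range L).map f) (i + 1) =
      if A δ P ((List.range (i + 1)).map f) = true ∧
          f i + loadAux A δ P ((List.range L).map f) i ≤ 1 then
        loadAux A δ P ((List.range L).map f) i + f i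
      else loadAux A δ P ((List.range L).map f) i := by
  have ht : ((List.range L).map f).take (i + 1) = (List.range (i + 1)).map f := by
    rw [← List.map_take, List.take_range, min_eq_left h]
  simp only [loadAux, getD_map_range f h, ht]

/-- Rejected items and items of size zero do not change the load. -/
theorem loadAux_eq_of_idle (A : OnlineAlg) (δ : ℝ) (P : List ℝ) (f : ℕ → ℝ) {L a b : ℕ}
    (hab : a ≤ b) (hb : b ≤ L)
    (h : ∀ i, a ≤ i → i < b → ¬ A δ P ((List.range (i + 1)).map f) = true ∨ f i = 0) :
    loadAux A δ P ((List.range L).map f) b = loadAux A δ P ((List.range L).map f) a := by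
  induction b, hab using Nat.le_induction with
  | base => rfl
  | succ n hn ih =>
    rw [← ih (by omega) fun i hi hi' => h i hi (by omega),
      loadAux_succ_map_range A δ P f (by omega)]
    rcases h n hn (by omega) with h | h <;> simp [h]

theorem sum_le_OPT_map_range (f : ℕ → ℝ) {L : ℕ} {S : Finset ℕ} (hS : S ⊆ Finset.range L)
    (h : ∑ i ∈ S, f i ≤ 1) : ∑ i ∈ S, f i ≤ OPT ((List.range L).map f) := by
  have he : ∑ i ∈ S, f i = ∑ i ∈ S, ((List.range L).map f).getD i 0 :=
    Finset.sum_congr rfl fun i hi => (getD_map_range f (Finset.mem_range.1 (hS hi))).symm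
  rw [he] at h ⊢
  exact Finset.le_sup' (fun S => ∑ i ∈ S, ((List.range L).map f).getD i 0)
    (Finset.mem_filter.2 ⟨Finset.mem_powerset.2 (by simpa using hS), h⟩)

/-- Sizes offered by the adversary: `m` items of size `ε`, then `r` items of size `u`,
then items of size zero up to position `M`, then `last`. -/
noncomputable def adversarySize (ε u last : ℝ) (m r M i : ℕ) : ℝ :=
  if i < m then ε else if i < m + r then u else if i < M then 0 else last

/-- `M` items announced as `δ`, followed by one item announced as `b`. -/
noncomputable def adversaryPrediction (δ b : ℝ) (M : ℕ) : List ℝ :=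
  (List.range (M + 1)).map fun i => if i < M then δ else b

theorem consistent_adversary {δ b ε u last : ℝ} {m r M : ℕ} (hmr : m + r ≤ M)
    (hδ : 0 ≤ δ) (hδ' : δ ≤ 1 / 2) (hε : 0 ≤ ε) (hεδ : ε ≤ 2 * δ) (hu : 0 ≤ u) (huδ : u ≤ 2 * δ)
    (hl : 0 ≤ last) (hl' : last ≤ 1) (hlb : b - δ ≤ last) (hbl : last ≤ b + δ) :
    Consistent δ (adversaryPrediction δ b M)
      ((List.range (M + 1)).map (adversarySize ε u last m r M)) := by
  refine ⟨by simp [adversaryPrediction], fun i hi => ?_⟩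
  have hi : i < M + 1 := by simpa using hi
  rw [adversaryPrediction, getD_map_range _ hi, getD_map_range _ hi]
  simp only [adversarySize]
  split_ifs <;> first | omega | (refine ⟨?_, ?_, ?_, ?_⟩ <;> linarith)

/-- After an initial phase with load `a`, offering items of size `u` followed by a suitable large
item keeps the gain below `q + 2 * ε`. -/
theorem exists_second_phase (A : OnlineAlg) {δ q ε u a : ℝ} {K N m : ℕ}
    (hδ : 0 ≤ δ) (hδ' : δ ≤ 1 / 2) (hε : 0 < ε) (hu : 0 < u)
    (hK : K * u = 1) (hN : N * ε = u) (huδ : u ≤ 2 * δ) (hq : q = 1 - 2 * δ - u) (huq : u ≤ q)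
    (hmN : m ≤ N) (ha : a = ε ∨ (a = 0 ∧ m = N))
    (hload : ∀ f : ℕ → ℝ, (∀ i < m, f i = ε) →
      loadAux A δ (adversaryPrediction δ (q + ε + δ) (N + K))
        ((List.range (N + K + 1)).map f) m = a) :
    ∃ P x : List ℝ, Consistent δ P x ∧ gain A δ P x ≤ q + 2 * ε ∧ 1 ≤ OPT x := by
  have hK0 : 0 < K := Nat.pos_of_ne_zero fun h => by simp [h] at hK
  have hN0 : 0 < N := Nat.pos_of_ne_zero fun h => by simp [h] at hN; linarith
  have hN1 : (1 : ℝ) ≤ N := by exact_mod_cast hN0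
  have hεu : ε ≤ u := by nlinarith
  have ha0 : 0 ≤ a := by rcases ha with h | ⟨h, -⟩ <;> linarith
  have haε : a ≤ ε := by rcases ha with h | ⟨h, -⟩ <;> linarith
  set P := adversaryPrediction δ (q + ε + δ) (N + K) with hP
  rcases forall_lt_not_or_exists_first (fun i => A δ P ((List.range (m + i + 1)).map
      fun i => if i < m then ε else u) = true) K with hrej | ⟨r, hrK, hacc, hrej⟩
  · set f := adversarySize ε u (q + ε) m K (N + K) with hf
    have hfm : ∀ i < m, f i = ε := fun i hi => by simp [hf, adversarySize, hi]
    have hM : loadAux A δ P ((List.range (N + K + 1)).map f) (N + K) = a := by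
      rw [← hload f hfm]
      refine loadAux_eq_of_idle A δ P f (by omega) (by omega) fun i hi hi' => ?_
      by_cases him : i < m + K
      · left
        have := hrej (i - m) (by omega)
        rw [show m + (i - m) + 1 = i + 1 by omega] at this
        rwa [map_range_congr (g := fun i => if i < m then ε else u)]
        intro j hj
        simp only [hf, adversarySize, show j < m + K by omega, if_true]
      · right
        simp [hf, adversarySize, him, hi', show ¬ i < m by omega]
    refine ⟨P, (List.range (N + K + 1)).map f,
      consistent_adversary (by omega) hδ hδ' hε.le (by linarith) hu.le huδ (by linarith)
        (by linarith) (by linarith) (by linarith), ?_, ?_⟩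
    · have hl : f (N + K) = q + ε := by
        simp [hf, adversarySize, show ¬ N + K < m by omega, hmN]
      rw [gain, List.length_map, List.length_range, loadAux_succ_map_range A δ P f (by omega),
        hM, hl]
      split_ifs <;> linarith
    · have hs : ∑ i ∈ Finset.Ico m (m + K), f i = 1 := by
        rw [Finset.sum_congr rfl (g := fun _ => u), Finset.sum_const, Nat.card_Ico, nsmul_eq_mul,
          Nat.add_sub_cancel_left, hK]
        intro i hi
        rw [Finset.mem_Ico] at hi
        simp [hf, adversarySize, hi.2, show ¬ i < m by omega]
      rw [← hs]
      refine sum_le_OPT_map_range f (fun i hi => ?_) hs.le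
      rw [Finset.mem_Ico] at hi
      rw [Finset.mem_range]
      omega
  · set last := 1 - u + ε - a with hlast
    set f := adversarySize ε u last m (r + 1) (N + K) with hf
    have hfm : ∀ i < m, f i = ε := fun i hi => by simp [hf, adversarySize, hi]
    have hfu : ∀ i, m ≤ i → i ≤ m + r → f i = u := fun i hi hi' => by
      simp [hf, adversarySize, show ¬ i < m by omega, show i < m + (r + 1) by omega]
    have hpre : ∀ i ≤ m + r, (List.range (i + 1)).map f =
        (List.range (i + 1)).map fun i => if i < m then ε else u := fun i hi =>
      map_range_congr fun j hj => by
        simp only [hf, adversarySize, show j < m + (r + 1) by omega, if_true]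
    have hl : f (N + K) = last := by
      simp [hf, adversarySize, show ¬ N + K < m by omega, show ¬ N + K < m + (r + 1) by omega]
    have hr : loadAux A δ P ((List.range (N + K + 1)).map f) (m + r) = a := by
      rw [← hload f hfm]
      refine loadAux_eq_of_idle A δ P f (by omega) (by omega) fun i hi hi' => Or.inl ?_
      have := hrej (i - m) (by omega)
      rw [show m + (i - m) + 1 = i + 1 by omega] at this
      rwa [hpre i (by omega)]
    have hM : loadAux A δ P ((List.range (N + K + 1)).map f) (N + K) = a + u := by
      rw [loadAux_eq_of_idle A δ P f (a := m + r + 1) (by omega) (by omega),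
        loadAux_succ_map_range A δ P f (by omega), hr, hfu _ (by omega) le_rfl, hpre _ le_rfl,
        if_pos ⟨hacc, by linarith⟩]
      intro i hi hi'
      right
      simp [hf, adversarySize, hi', show ¬ i < m by omega, show ¬ i < m + (r + 1) by omega]
    refine ⟨P, (List.range (N + K + 1)).map f,
      consistent_adversary (by omega) hδ hδ' hε.le (by linarith) hu.le huδ (by linarith)
        (by linarith) (by linarith) (by linarith), ?_, ?_⟩
    · rw [gain, List.length_map, List.length_range, loadAux_succ_map_range A δ P f (by omega),
        hM, hl, if_neg fun h => by linarith [h.2]]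
      linarith
    · rcases ha with ha | ⟨ha, hm⟩
      · have hs : ∑ i ∈ {m, N + K}, f i = 1 := by
          rw [Finset.sum_pair (by omega), hfu m le_rfl (by omega), hl]
          linarith
        rw [← hs]
        refine sum_le_OPT_map_range f (fun i hi => ?_) hs.le
        simp only [Finset.mem_insert, Finset.mem_singleton] at hi
        rw [Finset.mem_range]
        omega
      · have hs : ∑ i ∈ insert (N + K) (Finset.range (N - 1)), f i = 1 := by
          rw [Finset.sum_insert (by simp; omega), hl, Finset.sum_congr rfl (g := fun _ => ε),
            Finset.sum_const, Finset.card_range, nsmul_eq_mul, Nat.cast_sub hN0, Nat.cast_one]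
          · linarith
          · intro i hi
            rw [Finset.mem_range] at hi
            exact hfm i (by omega)
        rw [← hs]
        refine sum_le_OPT_map_range f (fun i hi => ?_) hs.le
        simp only [Finset.mem_insert, Finset.mem_range] at hi ⊢
        omega

theorem exists_adversary (A : OnlineAlg) {δ q ε u : ℝ} {K N : ℕ}
    (hδ : 0 ≤ δ) (hδ' : δ ≤ 1 / 2) (hε : 0 < ε) (hu : 0 < u)
    (hK : K * u = 1) (hN : N * ε = u) (huδ : u ≤ 2 * δ) (hq : q = 1 - 2 * δ - u) (huq : u ≤ q) :
    ∃ P x : List ℝ, Consistent δ P x ∧ gain A δ P x ≤ q + 2 * ε ∧ 1 ≤ OPT x := by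
  have hN0 : 0 < N := Nat.pos_of_ne_zero fun h => by simp [h] at hN; linarith
  have hN1 : (1 : ℝ) ≤ N := by exact_mod_cast hN0
  have hεu : ε ≤ u := by nlinarith
  set P := adversaryPrediction δ (q + ε + δ) (N + K) with hP
  have hpre : ∀ {f : ℕ → ℝ} {n i : ℕ}, (∀ i < n, f i = ε) → i < n →
      (List.range (i + 1)).map f = (List.range (i + 1)).map fun _ => ε := fun hf hi =>
    map_range_congr fun j hj => hf j (by omega)
  rcases forall_lt_not_or_exists_first
      (fun i => A δ P ((List.range (i + 1)).map fun _ => ε) = true) N with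
    hrej | ⟨m, hm, hacc, hrej⟩
  · refine exists_second_phase A hδ hδ' hε hu hK hN huδ hq huq le_rfl (Or.inr ⟨rfl, rfl⟩)
      fun f hf => ?_
    rw [loadAux_eq_of_idle A δ _ f (Nat.zero_le N) (by omega)]
    · rfl
    · intro i _ hi
      rw [hpre hf hi]
      exact Or.inl (hrej i hi)
  · refine exists_second_phase A hδ hδ' hε hu hK hN huδ hq huq hm (Or.inl rfl) fun f hf => ?_
    have h0 : loadAux A δ P ((List.range (N + K + 1)).map f) m = 0 := by
      rw [loadAux_eq_of_idle A δ P f (Nat.zero_le m) (by omega)]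
      · rfl
      · intro i _ hi
        rw [hpre hf (by omega)]
        exact Or.inl (hrej i hi)
    rw [Nat.succ_eq_add_one, loadAux_succ_map_range A δ P f (by omega), h0,
      hpre hf (Nat.lt_succ_self m), hf m (Nat.lt_succ_self m),
      if_pos ⟨hacc, by linarith⟩, zero_add]

theorem loadAux_nonneg (A : OnlineAlg) {δ : ℝ} {P x : List ℝ} (h : Consistent δ P x) {i : ℕ}
    (hi : i ≤ x.length) : 0 ≤ loadAux A δ P x i := by
  induction i with
  | zero => exact le_rfl
  | succ n ih =>
    have h₁ := ih (by omega)
    have h₂ := (h.2 n (by omega)).1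
    simp only [loadAux]
    split_ifs <;> linarith

/-- Lower bound `1/q`: for `3/16 < δ < 1/2`, no deterministic online algorithm
achieves a competitive ratio better than `1/q`. -/
theorem stmt_18 (δ : ℝ) (hδ0 : 3/16 < δ) (hδ1 : δ < 1/2)
    (k₂ : ℤ) (hk : k₂ = ⌈2/(1-2*δ)⌉)
    (q : ℝ) (hq : q = 1 - 2*δ - 1/(k₂:ℝ))
    (A : OnlineAlg) (c : ℝ) (hc : c < 1/q) :
    ∃ P x : List ℝ, Consistent δ P x ∧ c * gain A δ P x < OPT x := by
  have hs : 0 < 1 - 2 * δ := by linarith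
  have hk2 : 2 / (1 - 2 * δ) ≤ (k₂ : ℝ) := hk ▸ Int.le_ceil _
  have hk0 : (0 : ℝ) < k₂ := lt_of_lt_of_le (by positivity) hk2
  obtain ⟨K, rfl⟩ : ∃ K : ℕ, k₂ = K :=
    ⟨k₂.toNat, (Int.toNat_of_nonneg (by exact_mod_cast hk0.le)).symm⟩
  rw [Int.cast_natCast] at hk2 hk0 hq
  set u : ℝ := 1 / K with hu
  have hu0 : 0 < u := by positivity
  have hKu : K * u = 1 := by rw [hu]; field_simp
  have h2u : 2 * u ≤ 1 - 2 * δ := by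
    rw [div_le_iff₀ hs] at hk2
    rw [hu, mul_one_div, div_le_iff₀ hk0]
    linarith
  have hq0 : 0 < q := by linarith
  have hcq : c * q < 1 := (lt_div_iff₀ hq0).1 hc
  obtain ⟨N, hN⟩ := exists_nat_gt (2 * c * u / (1 - c * q))
  have hN1 : (0 : ℝ) < (N + 1 : ℕ) := by positivity
  have hε : c * (q + 2 * (u / (N + 1 : ℕ))) < 1 := by
    rw [div_lt_iff₀ (by linarith)] at hN
    have : 2 * c * u / (N + 1 : ℕ) < 1 - c * q := by
      rw [div_lt_iff₀ hN1]
      push_cast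
      linarith
    calc c * (q + 2 * (u / (N + 1 : ℕ))) = c * q + 2 * c * u / (N + 1 : ℕ) := by ring
      _ < 1 := by linarith
  obtain ⟨P, x, hcons, hgain, hopt⟩ := exists_adversary A (δ := δ) (q := q)
    (ε := u / (N + 1 : ℕ)) (u := u) (K := K) (N := N + 1) (by linarith) hδ1.le (by positivity)
    hu0 hKu (by field_simp) (by linarith) hq (by linarith)
  refine ⟨P, x, hcons, lt_of_lt_of_le ?_ hopt⟩
  have hg : 0 ≤ gain A δ P x := loadAux_nonneg A hcons le_rfl
  rcases le_total c 0 with h | h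
  · exact (mul_nonpos_of_nonpos_of_nonneg h hg).trans_lt one_pos
  · exact (mul_le_mul_of_nonneg_left hgain h).trans_lt hε
end

section
/- For every real δ with 0 < δ < 1/2, let k₁ = ⌊2/(1−2δ)⌋, k₂ = ⌈2/(1−2δ)⌉, p = −1/(2k₁) + √(1/(4k₁²) + (1−2δ)/k₁), and q = 1 − 2δ − 1/k₂. Then there exists a deterministic online algorithm A for the online simple knapsack with item size estimates that is (1/min(p,q))-competitive for accuracy δ: for every prediction list P and every instance x consistent with (P, δ), OPT(x) ≤ (1/min(p,q)) · gain_A(δ, P, x). -/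
/-- The load obtained on `x` by packing exactly the fitting items accepted by the rule `D`, which
sees the index, the current load and the current item. -/
noncomputable def ruleLoad (D : ℕ → ℝ → ℝ → Prop) (x : List ℝ) : ℕ → ℝ
  | 0 => 0
  | i + 1 =>
      open Classical in
      if D i (ruleLoad D x i) (x.getD i 0) ∧ x.getD i 0 + ruleLoad D x i ≤ 1 then
        ruleLoad D x i + x.getD i 0
      else ruleLoad D x i

/-- The online algorithm deciding by a rule that depends on the accuracy, the predictions, the
index, the current load and the current item. -/
noncomputable def ruleAlg (D : ℝ → List ℝ → ℕ → ℝ → ℝ → Prop) : OnlineAlg :=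
  fun δ P y => open Classical in
    decide (D δ P (y.length - 1) (ruleLoad (D δ P) y (y.length - 1)) (y.getD (y.length - 1) 0))

lemma ruleLoad_congr (D : ℕ → ℝ → ℝ → Prop) {x y : List ℝ} {i : ℕ}
    (h : ∀ j < i, x.getD j 0 = y.getD j 0) : ruleLoad D x i = ruleLoad D y i := by
  induction i with
  | zero => rfl
  | succ i ih =>
    simp only [ruleLoad]
    rw [ih fun j hj => h j (hj.trans i.lt_succ_self), h i i.lt_succ_self]

lemma getD_take_of_lt (x : List ℝ) {i j : ℕ} (h : j < i) :
    (x.take i).getD j 0 = x.getD j 0 := by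
  simp [List.getD_eq_getElem?_getD, h]

lemma loadAux_ruleAlg (D : ℝ → List ℝ → ℕ → ℝ → ℝ → Prop) (δ : ℝ) (P x : List ℝ) {i : ℕ}
    (hi : i ≤ x.length) : loadAux (ruleAlg D) δ P x i = ruleLoad (D δ P) x i := by
  induction i with
  | zero => rfl
  | succ i ih =>
    have hlen : (x.take (i + 1)).length - 1 = i := by simp; omega
    have hl : ruleLoad (D δ P) (x.take (i + 1)) i = ruleLoad (D δ P) x i :=
      ruleLoad_congr _ fun j hj => getD_take_of_lt x (by omega)
    classical
    have hdec : ruleAlg D δ P (x.take (i + 1)) = true ↔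
        D δ P i (ruleLoad (D δ P) x i) (x.getD i 0) := by
      simp only [ruleAlg, decide_eq_true_eq]
      rw [hlen, hl, getD_take_of_lt x i.lt_succ_self]
    simp only [loadAux, ruleLoad]
    rw [ih (by omega)]
    exact if_congr (and_congr_left' hdec) rfl rfl

/-- Accept an item if the load stays at most `b`, reaches `c`, or leaves room for every possible
future item. -/
def SafeToPack (b c δ : ℝ) (P : List ℝ) (i : ℕ) (l v : ℝ) : Prop :=
  l + v ≤ b ∨ c ≤ l + v ∨ ∀ j, i < j → j < P.length → P.getD j 0 ≤ 1 - (l + v) - δ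

/-- If some item is certain to have size at least `c`, accept only such items; otherwise accept
the items that are safe to pack. -/
def thresholdRule (b c δ : ℝ) (P : List ℝ) (i : ℕ) (l v : ℝ) : Prop :=
  ((∃ j < P.length, c + δ ≤ P.getD j 0) ∧ c + δ ≤ P.getD i 0) ∨
    ((¬ ∃ j < P.length, c + δ ≤ P.getD j 0) ∧ SafeToPack b c δ P i l v)

lemma le_ruleLoad_succ (D : ℕ → ℝ → ℝ → Prop) (x : List ℝ) (i : ℕ) (h : 0 ≤ x.getD i 0) :
    ruleLoad D x i ≤ ruleLoad D x (i + 1) := by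
  simp only [ruleLoad]
  split_ifs <;> linarith

lemma ruleLoad_mono (D : ℕ → ℝ → ℝ → Prop) (x : List ℝ) {i j : ℕ}
    (h : ∀ l < x.length, 0 ≤ x.getD l 0) (hij : i ≤ j) (hj : j ≤ x.length) :
    ruleLoad D x i ≤ ruleLoad D x j := by
  induction j, hij using Nat.le_induction with
  | base => exact le_rfl
  | succ j _ ih => exact (ih (by omega)).trans (le_ruleLoad_succ D x j (h j (by omega)))

lemma le_ruleLoad_of_large_prediction {b c δ : ℝ} {P x : List ℝ} (hx : Consistent δ P x)
    (hP : ∃ j < P.length, c + δ ≤ P.getD j 0) :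
    c ≤ ruleLoad (thresholdRule b c δ P) x x.length := by
  obtain ⟨hlen, hx⟩ := hx
  have key : ∀ i ≤ x.length, c ≤ ruleLoad (thresholdRule b c δ P) x i ∨
      (ruleLoad (thresholdRule b c δ P) x i = 0 ∧ ∀ j < i, ¬ c + δ ≤ P.getD j 0) := by
    intro i
    induction i with
    | zero => intro _; right; simp [ruleLoad]
    | succ i ih =>
      intro hi
      obtain ⟨h0, h1, h2, h3⟩ := hx i hi
      rcases ih (by omega) with h | ⟨h, hj⟩
      · left
        exact h.trans (le_ruleLoad_succ _ x i h0)
      · by_cases hc : c + δ ≤ P.getD i 0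
        · left
          have hD : thresholdRule b c δ P i 0 (x.getD i 0) := Or.inl ⟨hP, hc⟩
          simp only [ruleLoad]
          rw [h, if_pos ⟨hD, by linarith⟩]
          linarith
        · right
          have hD : ¬ thresholdRule b c δ P i 0 (x.getD i 0) := by
            rintro (h' | h')
            · exact hc h'.2
            · exact h'.1 hP
          refine ⟨?_, fun j hj' => ?_⟩
          · simp only [ruleLoad]
            rw [h, if_neg fun h' => hD h'.1]
          · rcases Nat.lt_succ_iff_lt_or_eq.mp hj' with h' | rfl
            exacts [hj j h', hc]
  rcases key x.length le_rfl with h | ⟨-, h⟩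
  · exact h
  · obtain ⟨j, hj, hc⟩ := hP
    exact absurd hc (h j (hlen ▸ hj))

lemma mul_sum_le_ruleLoad_of_small_predictions {b c δ : ℝ} {k₁ k₂ : ℤ} {P x : List ℝ}
    (hx : Consistent δ P x) (hP : ¬ ∃ j < P.length, c + δ ≤ P.getD j 0)
    (hc0 : 0 < c) (hc1 : c ≤ 1) (hbc : b + c = 1 - 2 * δ) (hk₂ : 0 < k₂) (hb₂ : 1 / (k₂ : ℝ) ≤ b)
    (hk : k₂ ≤ k₁ + 1) (hb₁ : (k₁ : ℝ) * c ^ 2 ≤ b)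
    (hfin : ruleLoad (thresholdRule b c δ P) x x.length < c)
    {S : Finset ℕ} (hS : S ⊆ Finset.range x.length) (hS1 : ∑ i ∈ S, x.getD i 0 ≤ 1) :
    c * ∑ i ∈ S, x.getD i 0 ≤ ruleLoad (thresholdRule b c δ P) x x.length := by
  classical
  obtain ⟨hlen, hx⟩ := hx
  set n := x.length
  set L := ruleLoad (thresholdRule b c δ P) x with hL
  have hx0 : ∀ j < n, 0 ≤ x.getD j 0 := fun j hj => (hx j hj).1
  have hmono : ∀ {i j}, i ≤ j → j ≤ n → L i ≤ L j := fun h h' => ruleLoad_mono _ x hx0 h h'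
  have hLc : ∀ i ≤ n, L i < c := fun i hi => (hmono hi le_rfl).trans_lt hfin
  have hrule : ∀ i l v, thresholdRule b c δ P i l v ↔ SafeToPack b c δ P i l v := by
    intro i l v
    simp only [thresholdRule, hP, false_and, not_false_eq_true, true_and, false_or]
  have hPlt : ∀ j < n, P.getD j 0 < c + δ := fun j hj =>
    lt_of_not_ge fun h => hP ⟨j, hlen ▸ hj, h⟩
  have hstep : ∀ i, L (i + 1) =
      if SafeToPack b c δ P i (L i) (x.getD i 0) ∧ x.getD i 0 + L i ≤ 1 then
        L i + x.getD i 0 else L i := by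
    intro i
    simp only [hL, ruleLoad, hrule]
  have hfits : ∀ i ≤ n, ∀ j, i ≤ j → j < n → x.getD j 0 + L i ≤ 1 := by
    intro i
    induction i with
    | zero =>
      intro _ j _ hj
      have h0 : L 0 = 0 := rfl
      linarith [(hx j hj).2.1]
    | succ i ih =>
      intro hi j hij hj
      have hold := ih (by omega) j (by omega) hj
      have hlt := hLc (i + 1) hi
      rw [hstep] at hlt ⊢
      obtain ⟨-, -, -, h3⟩ := hx j hj
      split_ifs at hlt ⊢ with hD
      · rcases hD.1 with h | h | h
        · linarith [hPlt j hj]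
        · linarith
        · linarith [h j (by omega) (hlen ▸ hj)]
      · exact hold
  set Q : ℕ → Prop := fun i => SafeToPack b c δ P i (L i) (x.getD i 0) with hQ
  have hstep' : ∀ i < n, L (i + 1) = if Q i then L i + x.getD i 0 else L i := by
    intro i hi
    rw [hstep]
    simp only [hQ, hfits i hi.le i le_rfl hi, and_true]
  have hsum : ∀ i ≤ n, L i = ∑ j ∈ (Finset.range i).filter Q, x.getD j 0 := by
    intro i
    induction i with
    | zero => intro _; simp [hL, ruleLoad]
    | succ i ih =>
      intro hi
      rw [hstep' i hi, Finset.range_add_one, Finset.filter_insert, ih (by omega)]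
      split_ifs
      · rw [Finset.sum_insert (by simp), add_comm]
      · rfl
  have hrej : ∀ i < n, ¬ Q i → b < L i + x.getD i 0 ∧ L i + x.getD i 0 < c ∧
      ∃ j, i < j ∧ j < n ∧ 1 - 2 * δ < x.getD j 0 + (L i + x.getD i 0) := by
    intro i hi h
    simp only [hQ, SafeToPack, not_or, not_le, not_forall] at h
    obtain ⟨h1, h2, j, hij, hj, h3⟩ := h
    rw [← hlen] at hj
    exact ⟨h1, h2, j, hij, hj, by linarith [(hx j hj).2.2.1]⟩
  have hL0 : ∀ i ≤ n, 0 ≤ L i := fun i hi => hmono i.zero_le hi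
  have hrej_gt : ∀ i < n, ¬ Q i → b < x.getD i 0 := by
    intro i hi h
    by_contra! hle
    obtain ⟨-, -, j, hij, hj, h3⟩ := hrej i hi h
    have hij' := hmono hij.le hj.le
    by_cases hQj : Q j
    · have := hLc (j + 1) hj
      rw [hstep' j hj, if_pos hQj] at this
      linarith
    · linarith [(hrej j hj hQj).2.1]
  have hltc : ∀ i < n, x.getD i 0 < c := by
    intro i hi
    have h0 := hL0 i hi.le
    by_cases hQi : Q i
    · have := hLc (i + 1) hi
      rw [hstep' i hi, if_pos hQi] at this
      linarith
    · linarith [(hrej i hi hQi).2.1]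
  have hSn : ∀ i ∈ S, i < n := fun i hi => Finset.mem_range.mp (hS hi)
  have hb0 : 0 < b := lt_of_lt_of_le (by positivity) hb₂
  rw [hsum n le_rfl]
  rcases ((Finset.range n).filter fun i => ¬ Q i).eq_empty_or_nonempty with hR | hR
  · have hall : ∀ i < n, Q i := by
      intro i hi
      by_contra h
      have : i ∈ (Finset.range n).filter fun i => ¬ Q i := by simp [hi, h]
      simp [hR] at this
    have hle : ∑ i ∈ S, x.getD i 0 ≤ ∑ j ∈ (Finset.range n).filter Q, x.getD j 0 := by
      refine Finset.sum_le_sum_of_subset_of_nonneg (fun i hi => ?_) fun i hi _ => ?_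
      · simp [hSn i hi, hall i (hSn i hi)]
      · exact hx0 i (Finset.mem_range.mp (Finset.mem_filter.mp hi).1)
    have hS0 : 0 ≤ ∑ i ∈ S, x.getD i 0 := Finset.sum_nonneg fun i hi => hx0 i (hSn i hi)
    nlinarith
  · obtain ⟨r, hrR, hmax⟩ := Finset.exists_max_image _ id hR
    obtain ⟨hrn, hrQ⟩ := Finset.mem_filter.mp hrR
    obtain ⟨-, hr2, y, hry, hyn, hy⟩ := hrej r (Finset.mem_range.mp hrn) hrQ
    have hyQ : Q y := by
      by_contra h
      have := hmax y (by simp [hyn, h])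
      simp only [id] at this
      omega
    have hyb : b < x.getD y 0 := by linarith
    have hyT : y ∈ (Finset.range n).filter Q := by simp [hyn, hyQ]
    have hsmall : ∑ i ∈ S.filter (fun i => ¬ b < x.getD i 0), x.getD i 0 ≤
        ∑ j ∈ ((Finset.range n).filter Q).erase y, x.getD j 0 := by
      refine Finset.sum_le_sum_of_subset_of_nonneg (fun i hi => ?_) fun i hi _ => ?_
      · obtain ⟨hiS, hib⟩ := Finset.mem_filter.mp hi
        have hin := hSn i hiS
        have hiQ : Q i := by
          by_contra h
          exact hib (hrej_gt i hin h)
        have hiy : i ≠ y := by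
          rintro rfl
          exact hib hyb
        simp [hin, hiQ, hiy]
      · have hi' := Finset.mem_of_mem_erase hi
        exact hx0 i (Finset.mem_range.mp (Finset.mem_filter.mp hi').1)
    have hErase := Finset.add_sum_erase ((Finset.range n).filter Q) (fun j => x.getD j 0) hyT
    have hsplit := Finset.sum_filter_add_sum_filter_not S (fun i => b < x.getD i 0)
      (fun i => x.getD i 0)
    set B := S.filter fun i => b < x.getD i 0
    have hBn : ∀ i ∈ B, i < n := fun i hi => hSn i (Finset.mem_filter.mp hi).1
    have hBle : ∑ i ∈ B, x.getD i 0 ≤ B.card * c := by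
      rw [← nsmul_eq_mul]
      exact Finset.sum_le_card_nsmul _ _ _ fun i hi => (hltc i (hBn i hi)).le
    have hBcard : (B.card : ℤ) < k₂ := by
      rcases B.eq_empty_or_nonempty with h | h
      · simpa [h] using hk₂
      · have h1 : (B.card : ℝ) * b < ∑ i ∈ B, x.getD i 0 := by
          rw [← nsmul_eq_mul, ← Finset.sum_const]
          exact Finset.sum_lt_sum_of_nonempty h fun i hi => (Finset.mem_filter.mp hi).2
        have h2 : ∑ i ∈ B, x.getD i 0 ≤ ∑ i ∈ S, x.getD i 0 :=
          Finset.sum_le_sum_of_subset_of_nonneg (Finset.filter_subset _ _)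
            fun i hi _ => hx0 i (hSn i hi)
        have hk₂' : (0 : ℝ) < k₂ := by exact_mod_cast hk₂
        have h3 : (B.card : ℝ) * (1 / k₂) < 1 :=
          (mul_le_mul_of_nonneg_left hb₂ (Nat.cast_nonneg _)).trans_lt (by linarith)
        rw [mul_one_div, div_lt_one hk₂'] at h3
        exact_mod_cast h3
    have hBk : (B.card : ℝ) ≤ k₁ := by exact_mod_cast (by omega : (B.card : ℤ) ≤ k₁)
    have hE0 : 0 ≤ ∑ j ∈ ((Finset.range n).filter Q).erase y, x.getD j 0 :=
      Finset.sum_nonneg fun i hi =>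
        hx0 i (Finset.mem_range.mp (Finset.mem_filter.mp (Finset.mem_of_mem_erase hi)).1)
    set E := ∑ j ∈ ((Finset.range n).filter Q).erase y, x.getD j 0
    calc c * ∑ i ∈ S, x.getD i 0 ≤ c * (k₁ * c + E) := by
          refine mul_le_mul_of_nonneg_left ?_ hc0.le
          linarith [mul_le_mul_of_nonneg_right hBk hc0.le]
      _ = k₁ * c ^ 2 + c * E := by ring
      _ ≤ b + E := add_le_add hb₁ (mul_le_of_le_one_left hE0 hc1)
      _ ≤ _ := by linarith

/-- The rule with thresholds `b` and `c` is `1 / c`-competitive. -/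
theorem competitive_thresholdRule {b c δ : ℝ} {k₁ k₂ : ℤ}
    (hc0 : 0 < c) (hc1 : c ≤ 1) (hbc : b + c = 1 - 2 * δ) (hk₂ : 0 < k₂) (hb₂ : 1 / (k₂ : ℝ) ≤ b)
    (hk : k₂ ≤ k₁ + 1) (hb₁ : (k₁ : ℝ) * c ^ 2 ≤ b) :
    Competitive (ruleAlg (thresholdRule b c)) δ (1 / c) := by
  intro P x hx
  rw [gain, loadAux_ruleAlg _ δ P x le_rfl, one_div, ← div_eq_inv_mul, le_div_iff₀ hc0, mul_comm]
  rw [← le_div_iff₀' hc0]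
  refine Finset.sup'_le _ _ fun S hS => ?_
  rw [le_div_iff₀' hc0]
  obtain ⟨hS, hS1⟩ := Finset.mem_filter.mp hS
  rw [Finset.mem_powerset] at hS
  rcases le_or_gt c (ruleLoad (thresholdRule b c δ P) x x.length) with h | h
  · exact (mul_le_of_le_one_right hc0.le hS1).trans h
  · exact mul_sum_le_ruleLoad_of_small_predictions hx
      (fun hP => (le_ruleLoad_of_large_prediction hx hP).not_gt h)
      hc0 hc1 hbc hk₂ hb₂ hk hb₁ h hS hS1

/-- Matching upper bound: for every `0 < δ < 1/2` there is a deterministic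
online algorithm that is `1/min(p,q)`-competitive. -/
theorem stmt_19 (δ : ℝ) (hδ0 : 0 < δ) (hδ1 : δ < 1/2)
    (k₁ : ℤ) (hk₁ : k₁ = ⌊2/(1-2*δ)⌋)
    (k₂ : ℤ) (hk₂ : k₂ = ⌈2/(1-2*δ)⌉)
    (p : ℝ)
    (hp : p = -1/(2*(k₁:ℝ)) + Real.sqrt (1/(4*(k₁:ℝ)^2) + (1-2*δ)/(k₁:ℝ)))
    (q : ℝ) (hq : q = 1 - 2*δ - 1/(k₂:ℝ)) :
    ∃ A : OnlineAlg, Competitive A δ (1/min p q) := by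
  have ha : 0 < 1 - 2 * δ := by linarith
  have hk₁2 : 2 ≤ k₁ := by
    rw [hk₁, Int.le_floor, le_div_iff₀ ha]
    push_cast
    linarith
  have hkk : k₂ ≤ k₁ + 1 := by
    rw [hk₁, hk₂]
    exact Int.ceil_le_floor_add_one _
  have hk₂le : 2 / (1 - 2 * δ) ≤ k₂ := hk₂ ▸ Int.le_ceil _
  have hk₂pos : (0 : ℝ) < k₂ := lt_of_lt_of_le (by positivity) hk₂le
  have hk₁pos : (2 : ℝ) ≤ k₁ := by exact_mod_cast hk₁2
  have hk₁0 : (0 : ℝ) < k₁ := by linarith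
  have hq0 : 0 < q := by
    rw [div_le_iff₀ ha] at hk₂le
    rw [hq, sub_pos, div_lt_iff₀ hk₂pos]
    linarith
  have hroot : (k₁ : ℝ) * p ^ 2 + p = 1 - 2 * δ := by
    have hs := Real.sq_sqrt (show 0 ≤ 1 / (4 * (k₁ : ℝ) ^ 2) + (1 - 2 * δ) / k₁ by positivity)
    set s := √(1 / (4 * (k₁ : ℝ) ^ 2) + (1 - 2 * δ) / k₁)
    have hexp : (k₁ : ℝ) * p ^ 2 + p = k₁ * s ^ 2 - 1 / (4 * k₁) := by
      rw [hp]
      field_simp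
      ring
    rw [hexp, hs]
    field_simp
    ring
  have hp0 : 0 < p := by
    have : 1 / (2 * (k₁ : ℝ)) < √(1 / (4 * (k₁ : ℝ) ^ 2) + (1 - 2 * δ) / k₁) := by
      apply Real.lt_sqrt_of_sq_lt
      have h : (1 / (2 * (k₁ : ℝ))) ^ 2 = 1 / (4 * (k₁ : ℝ) ^ 2) := by ring
      have : 0 < (1 - 2 * δ) / (k₁ : ℝ) := by positivity
      linarith
    rw [hp, neg_div]
    linarith
  have hc0 : 0 < min p q := lt_min hp0 hq0
  have hcp : min p q ≤ p := min_le_left _ _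
  have hcq : min p q ≤ q := min_le_right _ _
  have hsq : (k₁ : ℝ) * min p q ^ 2 ≤ k₁ * p ^ 2 := by gcongr
  refine ⟨ruleAlg (thresholdRule (1 - 2 * δ - min p q) (min p q)),
    competitive_thresholdRule (k₁ := k₁) (k₂ := k₂) hc0 ?_ (by ring) (by exact_mod_cast hk₂pos)
      (by linarith) hkk (by linarith)⟩
  have : 0 ≤ (k₁ : ℝ) * p ^ 2 := by positivity
  linarith
end
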